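/- arXiv:2310.15199 — 3 statements merged into one kernel-verified Lean document; each statement's English description precedes it below -/
import Mathlib

section
/- If f₁, f₂ ∈ k[x₁, x₂] and the Jacobian determinant ∂(f₁,f₂)/∂(x₁,x₂) is a nonzero constant (an element of k*), then the field extension degree [k(x₁,x₂) : k(f₁,f₂)] is at most deg(f₁)·deg(f₂). -/
open MvPolynomial

theorem two_mul_card_biUnion_antidiagonal (N : ℕ) :
    2 * ((Finset.range (N + 1)).biUnion Finset.HasAntidiagonal.antidiagonal).card = (N + 1) * (N + 2) := by
  rw [Finset.card_biUnion]
  · simp only [Finset.Nat.card_antidiagonal]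
    induction N with
    | zero => simp
    | succ n ih => rw [Finset.sum_range_succ, mul_add, ih]; ring
  · intro i _ j _ hij
    exact Finset.disjoint_left.mpr fun p hp hq ↦ hij <| by
      rw [Finset.HasAntidiagonal.mem_antidiagonal] at hp hq
      omega

theorem two_mul_finrank_restrictTotalDegree (k : Type*) [Field k] (m : ℕ) :
    2 * Module.finrank k (restrictTotalDegree (Fin 2) k m) = (m + 1) * (m + 2) := by
  rw [← two_mul_card_biUnion_antidiagonal m]
  let e : (Fin 2 →₀ ℕ) ≃ ℕ × ℕ := Finsupp.equivFunOnFinite.trans (finTwoArrowEquiv ℕ)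
  have h : {n : Fin 2 →₀ ℕ | (n.sum fun _ e ↦ e) ≤ m} ≃
      ((Finset.range (m + 1)).biUnion Finset.HasAntidiagonal.antidiagonal : Finset (ℕ × ℕ)) :=
    e.subtypeEquiv fun n ↦ by
      simp [e, Finsupp.sum_fintype]
  have hf := Module.finrank_eq_nat_card_basis
    (basisRestrictSupport k {n : Fin 2 →₀ ℕ | (n.sum fun _ e ↦ e) ≤ m})
  rw [Nat.card_congr h, Nat.card_eq_fintype_card, Fintype.card_coe] at hf
  exact congrArg (2 * ·) hf

theorem le_of_forall_quadratic_le {n D c : ℕ} (hD : 0 < D)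
    (h : ∀ N : ℕ, n * D * ((N + 1) * (N + 2)) ≤
      (D * (N + 2) + c + 1) * (D * (N + 2) + c + 2)) : n ≤ D := by
  by_contra! hn
  specialize h (D + 2 * c + 3 + (c + 1) * (c + 2))
  set q := (c + 1) * (c + 2) with hq
  set Y := D + 2 * c + 4 + q with hY
  have h1 : (D + 1) * D * (Y * (Y + 1)) ≤ n * D * (Y * (Y + 1)) := by gcongr; omega
  have h2 := h1.trans (h.trans_eq' (by rw [hY]; ring))
  have e : D + 2 * c + 3 + q + 2 = Y + 1 := by omega
  rw [e] at h2
  have h3 : (D * (Y + 1) + c + 1) * (D * (Y + 1) + c + 2) =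
    D ^ 2 * (Y + 1) ^ 2 + (2 * c + 3) * D * (Y + 1) + q := by rw [hq]; ring
  rw [h3] at h2
  have h4 : D * (Y + 1) * Y ≤ D * (Y + 1) * (D + 2 * c + 3) + q := by nlinarith
  have h5 : D * (Y + 1) * Y = D * (Y + 1) * (D + 2 * c + 3) + D * (Y + 1) * (q + 1) := by
    rw [hY]; ring
  have h6 : 1 ≤ D * (Y + 1) := Nat.mul_pos hD (by omega)
  nlinarith

theorem card_le_totalDegree_mul_totalDegree {k ι : Type*} [Field k] [Fintype ι]
    {f₁ f₂ : MvPolynomial (Fin 2) k} (h₁ : 0 < f₁.totalDegree) (h₂ : 0 < f₂.totalDegree)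
    (e : ι → MvPolynomial (Fin 2) k)
    (he : LinearIndependent k fun p : (ℕ × ℕ) × ι ↦ f₁ ^ p.1.1 * f₂ ^ p.1.2 * e p.2) :
    Fintype.card ι ≤ f₁.totalDegree * f₂.totalDegree := by
  set d₁ := f₁.totalDegree
  set d₂ := f₂.totalDegree
  let c := Finset.univ.sup fun i ↦ (e i).totalDegree
  refine le_of_forall_quadratic_le (c := c) (Nat.mul_pos h₁ h₂) fun N ↦ ?_
  let T := (Finset.range (N + 1)).biUnion Finset.HasAntidiagonal.antidiagonal
  let φ : (T × (Fin d₂ × Fin d₁)) × ι → (ℕ × ℕ) × ι := fun x ↦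
    ((d₂ * x.1.1.1.1 + x.1.2.1, d₁ * x.1.1.1.2 + x.1.2.2), x.2)
  have div_mod {d a a' : ℕ} (r r' : Fin d) (h : d * a + r = d * a' + r') : a = a' ∧ r = r' := by
    have hd : 0 < d := r.pos
    have h1 := congrArg (· / d) h
    have h2 := congrArg (· % d) h
    simp only [Nat.mul_add_div hd, Nat.mul_add_mod, Nat.div_eq_of_lt r.2, Nat.div_eq_of_lt r'.2,
      Nat.mod_eq_of_lt r.2, Nat.mod_eq_of_lt r'.2] at h1 h2
    exact ⟨h1, Fin.ext h2⟩
  have hφ : Function.Injective φ := by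
    rintro ⟨⟨⟨⟨s, t⟩, _⟩, r, q⟩, i⟩ ⟨⟨⟨⟨s', t'⟩, _⟩, r', q'⟩, i'⟩ h
    simp only [φ, Prod.mk.injEq] at h
    obtain ⟨⟨ha, hb⟩, hi⟩ := h
    obtain ⟨rfl, rfl⟩ := div_mod _ _ ha
    obtain ⟨rfl, rfl⟩ := div_mod _ _ hb
    subst hi
    rfl
  let M := d₁ * d₂ * (N + 2) + c
  have hdeg (x) : f₁ ^ (φ x).1.1 * f₂ ^ (φ x).1.2 * e (φ x).2 ∈
      restrictTotalDegree (Fin 2) k M := by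
    obtain ⟨⟨⟨⟨s, t⟩, hst⟩, r, q⟩, i⟩ := x
    have hst : s + t ≤ N := by simpa [T, Nat.lt_succ_iff] using hst
    rw [mem_restrictTotalDegree]
    have hi : (e i).totalDegree ≤ c :=
      Finset.le_sup (f := fun i ↦ (e i).totalDegree) (Finset.mem_univ i)
    calc _ ≤ (d₂ * s + r) * d₁ + (d₁ * t + q) * d₂ + c :=
          (totalDegree_mul _ _).trans <| add_le_add ((totalDegree_mul _ _).trans <|
            add_le_add (totalDegree_pow _ _) (totalDegree_pow _ _)) hi
      _ ≤ (d₂ * s + d₂) * d₁ + (d₁ * t + d₁) * d₂ + c := by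
          gcongr
          · exact r.2.le
          · exact q.2.le
      _ = d₁ * d₂ * (s + t + 2) + c := by ring
      _ ≤ M := by simp only [M]; gcongr
  have hli : LinearIndependent k fun x ↦ (⟨_, hdeg x⟩ : restrictTotalDegree (Fin 2) k M) :=
    .of_comp (Submodule.subtype _) (he.comp φ hφ)
  have hcard := hli.fintype_card_le_finrank
  simp only [Fintype.card_prod, Fintype.card_fin, Fintype.card_coe] at hcard
  have hT : 2 * T.card = _ := two_mul_card_biUnion_antidiagonal N
  have hM := two_mul_finrank_restrictTotalDegree k M
  calc _ = 2 * (T.card * (d₂ * d₁) * Fintype.card ι) := by rw [← hT]; ring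
    _ ≤ _ := Nat.mul_le_mul_left 2 hcard
    _ = _ := hM

theorem algebraicIndependent_of_isAlgebraic_adjoin {k K : Type*} [Field k] [Field K] [Algebra k K]
    [Algebra (MvPolynomial (Fin 2) k) K] [IsScalarTower k (MvPolynomial (Fin 2) k) K]
    [IsFractionRing (MvPolynomial (Fin 2) k) K] (x : Fin 2 → K)
    [Algebra.IsAlgebraic (IntermediateField.adjoin k (Set.range x)) K] :
    AlgebraicIndependent k x := by
  open scoped IntermediateField.algebraAdjoinAdjoin in
  have : Algebra.IsAlgebraic (Algebra.adjoin k (Set.range x)) K :=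
    (IsFractionRing.comap_isAlgebraic_iff (K := IntermediateField.adjoin k (Set.range x))).mpr ‹_›
  have : Algebra.IsAlgebraic (MvPolynomial (Fin 2) k) K :=
    IsLocalization.isAlgebraic _ (nonZeroDivisors (MvPolynomial (Fin 2) k))
  have hX := (IsTranscendenceBasis.mvPolynomial (Fin 2) k).algebraMap_comp (A := K)
  refine (Algebra.IsAlgebraic.isTranscendenceBasis_of_lift_le_trdeg_of_finite k x ?_).1
  exact hX.lift_cardinalMk_eq_trdeg.le

theorem linearIndependent_pow_mul_pow {k A : Type*} [Field k] [CommRing A] [Algebra k A]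
    {x : Fin 2 → A} (hx : AlgebraicIndependent k x) :
    LinearIndependent k fun p : ℕ × ℕ ↦ x 0 ^ p.1 * x 1 ^ p.2 := by
  let e : (Fin 2 →₀ ℕ) ≃ ℕ × ℕ := Finsupp.equivFunOnFinite.trans (finTwoArrowEquiv ℕ)
  have h := ((basisMonomials (Fin 2) k).linearIndependent.map' (aeval x).toLinearMap
    (LinearMap.ker_eq_bot.mpr hx)).comp e.symm e.symm.injective
  suffices (fun p : ℕ × ℕ ↦ x 0 ^ p.1 * x 1 ^ p.2) =
      ((aeval x).toLinearMap ∘ basisMonomials (Fin 2) k) ∘ e.symm by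
    rw [this]
    exact h
  funext p
  simp [e, aeval_monomial, Finsupp.prod_fintype]

theorem finrank_adjoin_pair_le {k K : Type*} [Field k] [Field K] [Algebra k K]
    [Algebra (MvPolynomial (Fin 2) k) K] [IsScalarTower k (MvPolynomial (Fin 2) k) K]
    [IsFractionRing (MvPolynomial (Fin 2) k) K] {f₁ f₂ : MvPolynomial (Fin 2) k}
    (h₁ : 0 < f₁.totalDegree) (h₂ : 0 < f₂.totalDegree) :
    Module.finrank (IntermediateField.adjoin k {algebraMap (MvPolynomial (Fin 2) k) K f₁,
      algebraMap (MvPolynomial (Fin 2) k) K f₂}) K ≤ f₁.totalDegree * f₂.totalDegree := by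
  let R := MvPolynomial (Fin 2) k
  let x : Fin 2 → K := ![algebraMap R K f₁, algebraMap R K f₂]
  have hrange : {algebraMap R K f₁, algebraMap R K f₂} = Set.range x := by
    simp [x, Matrix.range_cons, Set.pair_comm]
  rw [hrange]
  set F := IntermediateField.adjoin k (Set.range x)
  by_cases hfin : FiniteDimensional F K
  swap
  · simp [Module.finrank_of_not_finite hfin]
  have hxF (i) : x i ∈ F := IntermediateField.subset_adjoin _ _ ⟨i, rfl⟩
  let y : Fin 2 → F := fun i ↦ ⟨x i, hxF i⟩
  have hx : AlgebraicIndependent k x := algebraicIndependent_of_isAlgebraic_adjoin x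
  have hy : AlgebraicIndependent k y := AlgebraicIndependent.of_comp F.val hx
  let b := Module.finBasis F K
  obtain ⟨⟨q, hq⟩, hqb⟩ := IsLocalization.exist_integer_multiples_of_finite (nonZeroDivisors R) b
  choose e he using hqb
  have hq0 : algebraMap R K q ≠ 0 := by
    simpa using nonZeroDivisors.ne_zero hq
  have hli : LinearIndependent F fun i ↦ algebraMap R K (e i) := by
    have := b.linearIndependent.map' (LinearMap.mulLeft F (algebraMap R K q))
      (LinearMap.ker_eq_bot.mpr (mul_right_injective₀ hq0))
    simp only [he, Algebra.smul_def]
    exact this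
  have hprod := linearIndependent_smul (linearIndependent_pow_mul_pow hy) hli
  have hR : LinearIndependent k fun p : (ℕ × ℕ) × Fin (Module.finrank F K) ↦
      f₁ ^ p.1.1 * f₂ ^ p.1.2 * e p.2 := by
    refine .of_comp (IsScalarTower.toAlgHom k R K).toLinearMap ?_
    suffices (IsScalarTower.toAlgHom k R K).toLinearMap ∘
        (fun p : (ℕ × ℕ) × Fin (Module.finrank F K) ↦ f₁ ^ p.1.1 * f₂ ^ p.1.2 * e p.2) =
        fun p ↦ (y 0 ^ p.1.1 * y 1 ^ p.1.2) • algebraMap R K (e p.2) by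
      rw [this]
      exact hprod
    funext p
    simp [Algebra.smul_def, y, x, R, IntermediateField.algebraMap_apply]
  simpa using card_le_totalDegree_mul_totalDegree h₁ h₂ e hR

theorem stmt_2 {k : Type*} [Field k] (f₁ f₂ : MvPolynomial (Fin 2) k)
    (hJ : ∃ c : k, c ≠ 0 ∧
      pderiv 0 f₁ * pderiv 1 f₂ - pderiv 1 f₁ * pderiv 0 f₂ = C c) :
    let K := FractionRing (MvPolynomial (Fin 2) k)
    let F : IntermediateField k K :=
      IntermediateField.adjoin k
        {algebraMap (MvPolynomial (Fin 2) k) K f₁, algebraMap (MvPolynomial (Fin 2) k) K f₂}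
    Module.finrank F K ≤ f₁.totalDegree * f₂.totalDegree := by
  obtain ⟨c, hc, hJ⟩ := hJ
  refine finrank_adjoin_pair_le (Nat.pos_of_ne_zero fun h ↦ hc ?_)
    (Nat.pos_of_ne_zero fun h ↦ hc ?_) <;>
  · rw [totalDegree_eq_zero_iff_eq_C] at h
    rw [h] at hJ
    simpa using hJ.symm
end

section
/- Let f₁, f₂, u₁, u₂ ∈ k[x₁,x₂] such that the pairs (f₁,f₂) and (u₁,u₂) are each algebraically independent over k. Then k(x₁,x₂) is algebraic over k(f₁(u₁,u₂), f₂(u₁,u₂)) and [k(x₁,x₂) : k(f₁(u₁,u₂), f₂(u₁,u₂))] = [k(x₁,x₂) : k(u₁,u₂)] · [k(x₁,x₂) : k(f₁, f₂)]. -/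
open MvPolynomial

theorem IntermediateField.finrank_map_eq_fieldRange_mul {k K : Type*} [Field k] [Field K] [Algebra k K]
    (φ : K →ₐ[k] K) (E : IntermediateField k K) :
    Module.finrank (E.map φ) K = Module.finrank φ.fieldRange K * Module.finrank E K := by
  have h : E.map φ ≤ φ.fieldRange := by
    rw [AlgHom.fieldRange_eq_map]
    exact IntermediateField.map_mono φ le_top
  rw [← IntermediateField.relfinrank_mul_finrank_top h, AlgHom.fieldRange_eq_map,
    IntermediateField.relfinrank_map_map, IntermediateField.relfinrank_top_right, mul_comm]

theorem stmt_5 {k : Type*} [Field k] (f₁ f₂ u₁ u₂ : MvPolynomial (Fin 2) k)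
    (hf : AlgebraicIndependent k ![f₁, f₂])
    (hu : AlgebraicIndependent k ![u₁, u₂]) :
    let K := FractionRing (MvPolynomial (Fin 2) k)
    let ι : MvPolynomial (Fin 2) k →+* K := algebraMap _ _
    let F : IntermediateField k K :=
      IntermediateField.adjoin k
        {ι (aeval ![u₁, u₂] f₁), ι (aeval ![u₁, u₂] f₂)}
    let U : IntermediateField k K := IntermediateField.adjoin k {ι u₁, ι u₂}
    let Ff : IntermediateField k K := IntermediateField.adjoin k {ι f₁, ι f₂}
    Algebra.IsAlgebraic F K ∧
    Module.finrank F K = Module.finrank U K * Module.finrank Ff K := by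
  intro K ι F U Ff
  have hinj : Function.Injective (aeval ![u₁, u₂] : MvPolynomial (Fin 2) k →ₐ[k] _) := hu
  let g : MvPolynomial (Fin 2) k →ₐ[k] K :=
    (Algebra.algHom k (MvPolynomial (Fin 2) k) K).comp (aeval ![u₁, u₂])
  have hg : Function.Injective g :=
    (IsFractionRing.injective (MvPolynomial (Fin 2) k) K).comp hinj
  let φ : K →ₐ[k] K := IsFractionRing.liftAlgHom hg
  have hφ (p : MvPolynomial (Fin 2) k) : φ (ι p) = ι (aeval ![u₁, u₂] p) :=
    IsFractionRing.lift_algebraMap hg p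
  have hF : F = Ff.map φ := by
    simp only [F, Ff, IntermediateField.adjoin_map, Set.image_pair, hφ]
  have hU : U = φ.fieldRange := by
    refine (IsFractionRing.algHom_fieldRange_eq_of_comp_eq_of_range_eq (g := g)
      (RingHom.ext hφ) ?_).symm
    rw [AlgHom.range_comp, ← Algebra.adjoin_range_eq_range_aeval, AlgHom.map_adjoin]
    simp [Matrix.range_cons, Set.image_insert_eq, ι, Set.pair_comm]
    rfl
  refine ⟨?_, by rw [hF, hU, IntermediateField.finrank_map_eq_fieldRange_mul]⟩
  have hv : AlgebraicIndependent k (aeval ![u₁, u₂] ∘ ![f₁, f₂]) := hf.map' hinj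
  have : Algebra.IsAlgebraic (MvPolynomial (Fin 2) k) K :=
    IsLocalization.isAlgebraic _ (nonZeroDivisors (MvPolynomial (Fin 2) k))
  have hb := (hv.isTranscendenceBasis_of_lift_trdeg_le_of_finite
    (by simp [MvPolynomial.trdeg_of_isDomain])).algebraMap_comp (A := K)
  have hr : F = IntermediateField.adjoin k (Set.range (ι ∘ aeval ![u₁, u₂] ∘ ![f₁, f₂])) := by
    simp only [F, Set.range_comp, Matrix.range_cons, Matrix.range_empty, Set.union_empty,
      Set.singleton_union, Set.image_pair]
  rw [hr]
  exact hb.isAlgebraic_field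
end

section
/- Let k have characteristic p > 0 and let u = Σ_{i=s}^{t} α_i x₁^i x₂^{d−i} ∈ k[x₁,x₂] with α_s α_t ≠ 0 and 0 ≤ s ≤ t ≤ d. For i = 1,2 let f_i = x_i h_i(u) with h_i ∈ k[x]. If ∂(f₁,f₂)/∂(x₁,x₂) ∈ k*, then [k(x₁,x₂) : k(f₁,f₂)] = t·deg(h₁) + (d−s)·deg(h₂) + 1. -/
open MvPolynomial

/-- The polynomial `T h₁(T)^t h₂(T)^(d-s) - ∑ α_j h₁(T)^(t-j) h₂(T)^(j-s) a^j b^(d-j)` over `S`. -/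
noncomputable def relPoly {k S : Type*} [Field k] [CommRing S] [Algebra k S] (s t d : ℕ) (α : ℕ → k)
    (h₁ h₂ : Polynomial k) (a b : S) : Polynomial S :=
  (Polynomial.X * h₁ ^ t * h₂ ^ (d - s)).map (algebraMap k S) -
    ∑ j ∈ Finset.Icc s t, (Polynomial.C (α j) * h₁ ^ (t - j) * h₂ ^ (j - s)).map (algebraMap k S) *
      Polynomial.C (a ^ j * b ^ (d - j))

theorem natDegree_relPoly {k S : Type*} [Field k] [CommRing S] [Nontrivial S] [Algebra k S]
    {s t d : ℕ} (htd : t ≤ d) (α : ℕ → k)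
    {h₁ h₂ : Polynomial k} (hh₁ : h₁ ≠ 0) (hh₂ : h₂ ≠ 0) (a b : S) :
    (relPoly s t d α h₁ h₂ a b).natDegree = t * h₁.natDegree + (d - s) * h₂.natDegree + 1 := by
  have h1 : ((Polynomial.X * h₁ ^ t * h₂ ^ (d - s)).map (algebraMap k S)).natDegree
      = t * h₁.natDegree + (d - s) * h₂.natDegree + 1 := by
    rw [Polynomial.natDegree_map_eq_of_injective (algebraMap k S).injective,
      Polynomial.natDegree_mul (by simp [hh₁]) (by simp [hh₂]),
      Polynomial.natDegree_mul (by simp) (by simp [hh₁])]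
    simp
    ring
  rw [relPoly, Polynomial.natDegree_sub_eq_left_of_natDegree_lt, h1]
  rw [h1, Nat.lt_succ_iff]
  refine Polynomial.natDegree_sum_le_of_forall_le _ _ fun j hj => ?_
  rw [Finset.mem_Icc] at hj
  refine (Polynomial.natDegree_mul_C_le _ _).trans (Polynomial.natDegree_map_le.trans ?_)
  refine Polynomial.natDegree_mul_le.trans (add_le_add ?_ ?_)
  · refine (Polynomial.natDegree_C_mul_le _ _).trans (Polynomial.natDegree_pow_le.trans ?_)
    gcongr; omega
  · refine Polynomial.natDegree_pow_le.trans ?_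
    gcongr; omega

theorem aeval_relPoly_eq_zero {k S : Type*} [Field k] [CommRing S] [Algebra k S]
    {s t d : ℕ} (htd : t ≤ d) (α : ℕ → k) (h₁ h₂ : Polynomial k) (x y u : S)
    (hu : u = ∑ j ∈ Finset.Icc s t, algebraMap k S (α j) * x ^ j * y ^ (d - j)) :
    (relPoly s t d α h₁ h₂ (x * Polynomial.aeval u h₁) (y * Polynomial.aeval u h₂)).eval u = 0 := by
  simp only [relPoly, Polynomial.eval_sub, Polynomial.eval_finsetSum, Polynomial.eval_mul,
    Polynomial.eval_pow, Polynomial.eval_C, Polynomial.eval_map_algebraMap, mul_pow, map_mul, map_pow, Polynomial.aeval_X,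
    Polynomial.aeval_C]
  generalize Polynomial.aeval u h₁ = A
  generalize Polynomial.aeval u h₂ = B
  rw [mul_assoc, sub_eq_zero]
  nth_rw 1 [hu]
  rw [Finset.sum_mul]
  refine Finset.sum_congr rfl fun j hj => ?_
  rw [Finset.mem_Icc] at hj
  rw [show A ^ t = A ^ (t - j) * A ^ j by rw [← pow_add]; congr 1; omega,
    show B ^ (d - s) = B ^ (j - s) * B ^ (d - j) by rw [← pow_add]; congr 1; omega]
  ring

/-- Swapping the order of the variables: `k[Y₁, Y₂][T] → k[T][Y₁, Y₂]`. -/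
noncomputable def polyToMv (k : Type*) [Field k] :
    Polynomial (MvPolynomial (Fin 2) k) →+* MvPolynomial (Fin 2) (Polynomial k) :=
  Polynomial.eval₂RingHom (MvPolynomial.map Polynomial.C) (C Polynomial.X)

/-- The inverse of `polyToMv`. -/
noncomputable def mvToPoly (k : Type*) [Field k] :
    MvPolynomial (Fin 2) (Polynomial k) →+* Polynomial (MvPolynomial (Fin 2) k) :=
  eval₂Hom (Polynomial.mapRingHom C) (fun i => Polynomial.C (X i))

theorem mvToPoly_polyToMv {k : Type*} [Field k] (q : Polynomial (MvPolynomial (Fin 2) k)) :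
    mvToPoly k (polyToMv k q) = q := by
  have : (mvToPoly k).comp (polyToMv k) = RingHom.id _ := by
    ext <;> simp [mvToPoly, polyToMv]
  exact congr($this q)

theorem polyToMv_mvToPoly {k : Type*} [Field k] (q : MvPolynomial (Fin 2) (Polynomial k)) :
    polyToMv k (mvToPoly k q) = q := by
  have : (polyToMv k).comp (mvToPoly k) = RingHom.id _ := by
    ext <;> simp [mvToPoly, polyToMv]
  exact congr($this q)

/-- The substitution `Y_i ↦ h_i Y_i`. -/
noncomputable def scaleVars {σ A : Type*} [CommRing A] (h : σ → A) :
    MvPolynomial σ A →ₐ[A] MvPolynomial σ A :=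
  aeval fun i => X i * C (h i)

@[simp]
theorem scaleVars_C {σ A : Type*} [CommRing A] (h : σ → A) (a : A) :
    scaleVars h (C a) = C a := by
  simp [scaleVars]

theorem coeff_scaleVars {σ A : Type*} [CommRing A] (h : σ → A) (w : MvPolynomial σ A) (m : σ →₀ ℕ) :
    coeff m (scaleVars h w) = coeff m w * m.prod fun i n => h i ^ n := by
  classical
  induction w using MvPolynomial.induction_on' with
  | add p q hp hq => simp [hp, hq, add_mul]
  | monomial n a =>
    have : scaleVars h (monomial n a) = monomial n (a * n.prod fun i n => h i ^ n) := by
      simp only [scaleVars, aeval_monomial, mul_pow, Finsupp.prod_mul, algebraMap_eq]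
      rw [monomial_eq, C_mul]
      simp only [Finsupp.prod, map_prod, map_pow]
      ring
    rw [this, coeff_monomial, coeff_monomial]
    split_ifs with hnm
    · rw [hnm]
    · simp

theorem scaleVars_injective {σ A : Type*} [CommRing A] [IsDomain A] {h : σ → A}
    (hh : ∀ i, h i ≠ 0) : Function.Injective (scaleVars h) := by
  intro v w hvw
  ext m
  have := congr(coeff m $hvw)
  rw [coeff_scaleVars, coeff_scaleVars] at this
  exact mul_right_cancel₀ (Finset.prod_ne_zero_iff.mpr fun i _ => pow_ne_zero _ (hh i)) this

theorem exists_scaleVars_eq {σ A : Type*} [Fintype σ] [CommRing A] (h : σ → A)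
    (w : MvPolynomial σ A) :
    ∃ (N : ℕ) (v : MvPolynomial σ A), scaleVars h v = C ((∏ i, h i) ^ N) * w := by
  classical
  induction w using MvPolynomial.induction_on with
  | C a => exact ⟨0, C a, by simp⟩
  | add p q hp hq =>
    obtain ⟨N, v, hv⟩ := hp
    obtain ⟨M, w, hw⟩ := hq
    refine ⟨N + M, C ((∏ i, h i) ^ M) * v + C ((∏ i, h i) ^ N) * w, ?_⟩
    rw [map_add, map_mul, map_mul, scaleVars_C, scaleVars_C, hv, hw, pow_add, C_mul]
    ring
  | mul_X p i hp =>
    obtain ⟨N, v, hv⟩ := hp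
    refine ⟨N + 1, C (∏ j ∈ Finset.univ.erase i, h j) * v * X i, ?_⟩
    have hX : scaleVars h (X i) = X i * C (h i) := by simp [scaleVars]
    rw [map_mul, map_mul, scaleVars_C, hX, hv, pow_succ, C_mul,
      ← Finset.mul_prod_erase Finset.univ h (Finset.mem_univ i)]
    simp only [C_mul]
    ring

theorem isRelPrime_C_of_coeff {σ A : Type*} [CommRing A] [IsDomain A] {P : MvPolynomial σ A}
    {a : A} (ha : a ≠ 0) (hP : ∀ g : A, (∀ m, g ∣ coeff m P) → IsUnit g) : IsRelPrime P (C a) := by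
  rintro g hgP ⟨g', hg'⟩
  have h0 : g * g' ≠ 0 := by rw [← hg']; simpa using ha
  have hdeg := totalDegree_mul_of_isDomain (left_ne_zero_of_mul h0) (right_ne_zero_of_mul h0)
  rw [← hg', totalDegree_C] at hdeg
  have hg : g = C (coeff 0 g) := totalDegree_eq_zero_iff_eq_C.mp (by omega)
  rw [hg] at hgP ⊢
  exact (hP _ ((C_dvd_iff_dvd_coeff _ _).mp hgP)).map C

theorem polyToMv_map {k : Type*} [Field k] (q : Polynomial k) :
    polyToMv k (q.map (algebraMap k _)) = C q := by
  have : (polyToMv k).comp (Polynomial.mapRingHom (algebraMap k _)) = C := by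
    ext <;> simp [polyToMv, algebraMap_eq]
  exact congr($this q)

theorem polyToMv_C {k : Type*} [Field k] (q : MvPolynomial (Fin 2) k) :
    polyToMv k (Polynomial.C q) = map Polynomial.C q := by
  simp [polyToMv]

theorem polyToMv_relPoly {k : Type*} [Field k] (s t d : ℕ) (α : ℕ → k) (h₁ h₂ : Polynomial k) :
    polyToMv k (relPoly s t d α h₁ h₂ (X 0) (X 1)) =
      C (Polynomial.X * h₁ ^ t * h₂ ^ (d - s)) - ∑ j ∈ Finset.Icc s t,
        C (Polynomial.C (α j) * h₁ ^ (t - j) * h₂ ^ (j - s)) * (X 0 ^ j * X 1 ^ (d - j)) := by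
  rw [relPoly, map_sub, map_sum, polyToMv_map]
  congr 1
  refine Finset.sum_congr rfl fun j _ => ?_
  rw [map_mul, polyToMv_map, polyToMv_C]
  simp

theorem coeff_polyToMv_relPoly {k : Type*} [Field k] {s t d : ℕ} (hd : 0 < d)
    (α : ℕ → k) (h₁ h₂ : Polynomial k) {i : ℕ} (hi : i ∈ Finset.Icc s t) :
    coeff (Finsupp.single 0 i + Finsupp.single 1 (d - i))
      (polyToMv k (relPoly s t d α h₁ h₂ (X 0) (X 1))) =
      -(Polynomial.C (α i) * h₁ ^ (t - i) * h₂ ^ (i - s)) := by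
  classical
  have hmon (j : ℕ) (a : Polynomial k) :
      C a * (X 0 ^ j * X 1 ^ (d - j)) =
        monomial (Finsupp.single (0 : Fin 2) j + Finsupp.single 1 (d - j)) a := by
    rw [X_pow_eq_monomial, X_pow_eq_monomial, monomial_mul, C_mul_monomial]
    simp
  have hne : (0 : Fin 2 →₀ ℕ) ≠ Finsupp.single 0 i + Finsupp.single 1 (d - i) := by
    intro h
    have h0 := congr($h 0)
    have h1 := congr($h 1)
    simp at h0 h1
    omega
  rw [polyToMv_relPoly, coeff_sub, coeff_C, if_neg hne, zero_sub, coeff_sum,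
    Finset.sum_eq_single_of_mem i hi]
  · rw [hmon, coeff_monomial, if_pos rfl]
  · intro j _ hji
    rw [hmon, coeff_monomial, if_neg]
    intro h
    exact hji (by simpa using congr($h 0))

theorem isUnit_of_dvd_coeff_relPoly {k : Type*} [Field k] {s t d : ℕ} (hd : 0 < d) (hst : s ≤ t)
    {α : ℕ → k} (hαs : α s ≠ 0) (hαt : α t ≠ 0) {h₁ h₂ : Polynomial k}
    (hcop : s < t → IsCoprime h₁ h₂) (g : Polynomial k)
    (hg : ∀ m, g ∣ coeff m (polyToMv k (relPoly s t d α h₁ h₂ (X 0) (X 1)))) : IsUnit g := by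
  have hs := hg (Finsupp.single 0 s + Finsupp.single 1 (d - s))
  have ht := hg (Finsupp.single 0 t + Finsupp.single 1 (d - t))
  rw [coeff_polyToMv_relPoly hd α h₁ h₂ (by simp [hst]), dvd_neg, mul_assoc,
    (Polynomial.isUnit_C.mpr hαs.isUnit).dvd_mul_left, Nat.sub_self, pow_zero, mul_one] at hs
  rw [coeff_polyToMv_relPoly hd α h₁ h₂ (by simp [hst]), dvd_neg, mul_assoc,
    (Polynomial.isUnit_C.mpr hαt.isUnit).dvd_mul_left, Nat.sub_self, pow_zero, one_mul] at ht
  rcases hst.eq_or_lt with rfl | hlt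
  · exact isUnit_of_dvd_one (by simpa using hs)
  · exact (hcop hlt).pow.isUnit_of_dvd' hs ht

/-- The form `∑ α_i x₁^i x₂^(d-i)`, for `s ≤ i ≤ t`, in `k[x₁, x₂]`. -/
noncomputable def homogSum {k : Type*} [Field k] (s t d : ℕ) (α : ℕ → k) : MvPolynomial (Fin 2) k :=
  ∑ j ∈ Finset.Icc s t, C (α j) * X 0 ^ j * X 1 ^ (d - j)

theorem scaleVars_relPoly {k : Type*} [Field k] {s t d : ℕ} (htd : t ≤ d)
    (α : ℕ → k) (h₁ h₂ : Polynomial k) :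
    scaleVars ![h₁, h₂] (polyToMv k (relPoly s t d α h₁ h₂ (X 0) (X 1))) =
      C (h₁ ^ t * h₂ ^ (d - s)) *
        polyToMv k (Polynomial.X - Polynomial.C (homogSum s t d α)) := by
  rw [polyToMv_relPoly, map_sub, map_sub, mul_sub, map_sum, polyToMv_C, homogSum, map_sum,
    Finset.mul_sum]
  congr 1
  · simp [scaleVars, polyToMv]
    ring
  refine Finset.sum_congr rfl fun j hj => ?_
  rw [Finset.mem_Icc] at hj
  simp only [scaleVars, map_mul, map_pow, aeval_X, algHom_C, algebraMap_eq, map_C, map_X,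
    Matrix.cons_val_zero, Matrix.cons_val_one, mul_pow]
  rw [show t = (t - j) + j by omega, show d - s = (j - s) + (d - j) by omega]
  simp only [pow_add, Nat.add_sub_cancel]
  ring

theorem relPoly_dvd {k : Type*} [Field k] {s t d : ℕ} (hd : 0 < d) (hst : s ≤ t) (htd : t ≤ d)
    {α : ℕ → k} (hαs : α s ≠ 0) (hαt : α t ≠ 0) {h₁ h₂ : Polynomial k}
    (hh₁ : h₁ ≠ 0) (hh₂ : h₂ ≠ 0)
    (hcop : s < t → IsCoprime h₁ h₂) (Q : Polynomial (MvPolynomial (Fin 2) k))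
    (hQ : Q.eval₂ (aeval ![X 0 * Polynomial.aeval (homogSum s t d α) h₁,
      X 1 * Polynomial.aeval (homogSum s t d α) h₂] :
        MvPolynomial (Fin 2) k →ₐ[k] MvPolynomial (Fin 2) k).toRingHom (homogSum s t d α) = 0) :
    relPoly s t d α h₁ h₂ (X 0) (X 1) ∣ Q := by
  set u := homogSum s t d α with hu
  have hh : ∀ i, (![h₁, h₂] : Fin 2 → Polynomial k) i ≠ 0 := by
    intro i; fin_cases i <;> simpa
  have hdvd : Polynomial.X - Polynomial.C u ∣
      mvToPoly k (scaleVars ![h₁, h₂] (polyToMv k Q)) := by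
    rw [Polynomial.dvd_iff_isRoot, Polynomial.IsRoot, ← hQ]
    have : (((Polynomial.evalRingHom u).comp (mvToPoly k)).comp
        (scaleVars ![h₁, h₂]).toRingHom).comp (polyToMv k) = Polynomial.eval₂RingHom
        (aeval ![X 0 * Polynomial.aeval u h₁, X 1 * Polynomial.aeval u h₂] :
        MvPolynomial (Fin 2) k →ₐ[k] MvPolynomial (Fin 2) k).toRingHom u := by
      refine Polynomial.ringHom_ext' (MvPolynomial.ringHom_ext (fun a => ?_) fun i => ?_) ?_
      · simp [polyToMv, mvToPoly, scaleVars, algebraMap_eq]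
      · fin_cases i <;>
        simp [polyToMv, mvToPoly, scaleVars, Polynomial.aeval_def, Polynomial.eval_map,
          algebraMap_eq]
      · simp [polyToMv, mvToPoly, scaleVars]
    exact congr($this Q)
  obtain ⟨W, hW⟩ := (map_dvd (polyToMv k) hdvd)
  rw [polyToMv_mvToPoly] at hW
  obtain ⟨N, V, hV⟩ := exists_scaleVars_eq ![h₁, h₂] W
  set a : Polynomial k := (∏ i, ![h₁, h₂] i) ^ N * (h₁ ^ t * h₂ ^ (d - s)) with ha
  have ha0 : a ≠ 0 :=
    mul_ne_zero (pow_ne_zero _ (Finset.prod_ne_zero_iff.mpr fun i _ => hh i))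
      (mul_ne_zero (pow_ne_zero _ hh₁) (pow_ne_zero _ hh₂))
  have key : C a * polyToMv k Q = polyToMv k (relPoly s t d α h₁ h₂ (X 0) (X 1)) * V := by
    apply scaleVars_injective hh
    rw [map_mul (scaleVars _) (C a), map_mul (scaleVars _), scaleVars_relPoly htd, hW, hV, ha,
      scaleVars_C]
    simp only [C_mul]
    ring
  have hrel := isRelPrime_C_of_coeff ha0
    (isUnit_of_dvd_coeff_relPoly hd hst hαs hαt hcop)
  have := map_dvd (mvToPoly k) (hrel.dvd_of_dvd_mul_left ⟨V, key⟩)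
  rwa [mvToPoly_polyToMv, mvToPoly_polyToMv] at this

theorem isCoprime_of_jacobian {k : Type*} [Field k] {s t d : ℕ} (hst : s < t)
    {α : ℕ → k} (hαt : α t ≠ 0) {h₁ h₂ : Polynomial k} {c : k} (hc : c ≠ 0)
    (hJ : pderiv 0 (X 0 * Polynomial.aeval (homogSum s t d α) h₁) *
          pderiv 1 (X 1 * Polynomial.aeval (homogSum s t d α) h₂) -
        pderiv 1 (X 0 * Polynomial.aeval (homogSum s t d α) h₁) *
          pderiv 0 (X 1 * Polynomial.aeval (homogSum s t d α) h₂) = C c) :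
    IsCoprime h₁ h₂ := by
  rw [← isRelPrime_iff_isCoprime]
  rintro g ⟨a, rfl⟩ ⟨b, rfl⟩
  have hG : IsUnit (Polynomial.aeval (homogSum s t d α) g) := by
    refine isUnit_of_dvd_unit ?_ ((isUnit_iff_ne_zero.mpr hc).map (C (σ := Fin 2)))
    rw [← hJ]
    simp only [map_mul]
    generalize Polynomial.aeval (homogSum s t d α) g = G
    rw [mul_left_comm, mul_left_comm (X 1)]
    generalize X 0 * Polynomial.aeval (homogSum s t d α) a = A
    generalize X 1 * Polynomial.aeval (homogSum s t d α) b = B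
    simp only [Derivation.leibniz, smul_eq_mul]
    refine ⟨G * (pderiv 0 A * pderiv 1 B - pderiv 1 A * pderiv 0 B) +
      B * (pderiv 0 A * pderiv 1 G - pderiv 1 A * pderiv 0 G) +
      A * (pderiv 0 G * pderiv 1 B - pderiv 1 G * pderiv 0 B), ?_⟩
    ring
  let v : Polynomial k := ∑ j ∈ Finset.Icc s t, Polynomial.C (α j) * Polynomial.X ^ j
  have hv : aeval ![Polynomial.X, 1] (homogSum s t d α) = v := by
    simp [homogSum, v, Polynomial.C_eq_algebraMap]
  have hcomp := hG.map (aeval (R := k) ![(Polynomial.X : Polynomial k), 1])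
  rw [← Polynomial.aeval_algHom_apply, hv] at hcomp
  have hvdeg : t ≤ v.natDegree := by
    apply Polynomial.le_natDegree_of_ne_zero
    simpa [v, Polynomial.finsetSum_coeff, hst.le] using hαt
  have h0 := Polynomial.natDegree_eq_zero_of_isUnit hcomp
  rw [← Polynomial.comp_eq_aeval, Polynomial.natDegree_comp] at h0
  have hg0 : g ≠ 0 := by rintro rfl; simp at hG
  have : g.natDegree = 0 := (mul_eq_zero.mp h0).resolve_right (by omega)
  rw [Polynomial.eq_C_of_natDegree_eq_zero this] at hg0 ⊢
  exact Polynomial.isUnit_C.mpr (isUnit_iff_ne_zero.mpr (by rintro h; simp [h] at hg0))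

theorem adjoin_adjoin_eq_top {k K : Type*} [Field k] [Field K] [Algebra k K]
    [Algebra (MvPolynomial (Fin 2) k) K] [IsFractionRing (MvPolynomial (Fin 2) k) K]
    [IsScalarTower k (MvPolynomial (Fin 2) k) K] {h₁ h₂ : Polynomial k}
    (u : MvPolynomial (Fin 2) k) (hA : Polynomial.aeval u h₁ ≠ 0) (hB : Polynomial.aeval u h₂ ≠ 0)
    (F : IntermediateField k K)
    (hf₁ : algebraMap _ _ (X 0 * Polynomial.aeval u h₁) ∈ F)
    (hf₂ : algebraMap _ _ (X 1 * Polynomial.aeval u h₂) ∈ F) :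
    IntermediateField.adjoin F
      {algebraMap (MvPolynomial (Fin 2) k) K u} = ⊤ := by
  set L := IntermediateField.adjoin F {algebraMap _ K u} with hL
  have hFL {x : K} (hx : x ∈ F) : x ∈ L := L.algebraMap_mem ⟨x, hx⟩
  have huL : algebraMap _ K u ∈ L := IntermediateField.mem_adjoin_simple_self _ _
  have haev (h : Polynomial k) : algebraMap _ K (Polynomial.aeval u h) ∈ L := by
    rw [← Polynomial.aeval_algebraMap_apply]
    exact Algebra.adjoin_le (S := (L.restrictScalars k).toSubalgebra)
      (Set.singleton_subset_iff.mpr huL) (Polynomial.aeval_mem_adjoin_singleton k _)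
  have hX (i : Fin 2) (h : Polynomial k) (h0 : Polynomial.aeval u h ≠ 0)
      (hf : algebraMap _ K (X i * Polynomial.aeval u h) ∈ F) :
        algebraMap (MvPolynomial (Fin 2) k) K (X i) ∈ L := by
    have h0' : algebraMap _ K (Polynomial.aeval u h) ≠ 0 := by simpa using h0
    rw [eq_div_of_mul_eq h0' (map_mul (algebraMap _ K) _ _).symm]
    exact div_mem (hFL hf) (haev h)
  have hall (a : MvPolynomial (Fin 2) k) : algebraMap _ K a ∈ L := by
    induction a using MvPolynomial.induction_on with
    | C a =>
      apply hFL
      rw [← algebraMap_eq, ← IsScalarTower.algebraMap_apply]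
      exact F.algebraMap_mem a
    | add p q hp hq => rw [map_add]; exact add_mem hp hq
    | mul_X p i hp =>
      rw [map_mul]
      refine mul_mem hp ?_
      fin_cases i
      · exact hX 0 h₁ hA hf₁
      · exact hX 1 h₂ hB hf₂
  rw [eq_top_iff]
  rintro z -
  obtain ⟨a, b, -, rfl⟩ := IsFractionRing.div_surjective (A := MvPolynomial (Fin 2) k) z
  exact div_mem (hall a) (hall b)

open scoped IntermediateField.algebraAdjoinAdjoin in
/-- An algebraic relation over the field `k(v)` can be cleared of denominators, without raising
the degree. -/
theorem exists_polynomial_of_aeval_adjoin {k K σ : Type*} [Field k] [Field K] [Algebra k K]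
    (v : σ → K) (m : Polynomial (IntermediateField.adjoin k (Set.range v))) (hm : m ≠ 0)
    {x : K} (hx : Polynomial.aeval x m = 0) :
    ∃ Q : Polynomial (MvPolynomial σ k), Q ≠ 0 ∧ Q.natDegree ≤ m.natDegree ∧
      Q.eval₂ (aeval v : MvPolynomial σ k →ₐ[k] K).toRingHom x = 0 := by
  set B := Algebra.adjoin k (Set.range v) with hB
  let q : Polynomial B := IsLocalization.integerNormalization (nonZeroDivisors B) m
  have hq0 : q ≠ 0 := by
    rwa [Ne, IsFractionRing.integerNormalization_eq_zero_iff]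
  have hqx : Polynomial.aeval x q = 0 :=
    IsLocalization.integerNormalization_aeval_eq_zero _ _ hx
  have hqd : q.natDegree ≤ m.natDegree :=
    Polynomial.natDegree_le_natDegree <| Polynomial.degree_mono
      (IsLocalization.integerNormalization_support _ _)
  have hlift : q.map (algebraMap B K) ∈
      Polynomial.lifts (aeval v : MvPolynomial σ k →ₐ[k] K).toRingHom := by
    rw [Polynomial.lifts_iff_coeff_lifts]
    intro n
    rw [Polynomial.coeff_map]
    exact (Algebra.adjoin_range_eq_range_aeval k v).le (q.coeff n).2
  obtain ⟨Q, hQ, hdeg⟩ := Polynomial.exists_degree_eq_of_mem_lifts hlift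
  have hinj : Function.Injective (algebraMap B K) := Subtype.val_injective
  have hdeg' : Q.degree = q.degree := by
    rw [hdeg, Polynomial.degree_map_eq_of_injective hinj]
  refine ⟨Q, ?_, ?_, ?_⟩
  · rw [← Polynomial.degree_ne_bot, hdeg', Polynomial.degree_ne_bot]; exact hq0
  · rwa [Polynomial.natDegree_eq_of_degree_eq hdeg']
  · rw [← Polynomial.eval_map, hQ, Polynomial.eval_map]; exact hqx

theorem map_relPoly {k S S' : Type*} [Field k] [CommRing S] [CommRing S'] [Algebra k S]
    [Algebra k S'] [Algebra S S'] [IsScalarTower k S S'] (s t d : ℕ) (α : ℕ → k)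
    (h₁ h₂ : Polynomial k) (a b : S) :
    (relPoly s t d α h₁ h₂ a b).map (algebraMap S S') =
      relPoly s t d α h₁ h₂ (algebraMap S S' a) (algebraMap S S' b) := by
  simp only [relPoly, Polynomial.map_sub, Polynomial.map_sum, Polynomial.map_mul,
    Polynomial.map_pow, Polynomial.map_map, Polynomial.map_C, Polynomial.map_X, map_mul, map_pow,
    ← IsScalarTower.algebraMap_eq, ← IsScalarTower.algebraMap_apply]

theorem finrank_adjoin {k K : Type*} [Field k] [Field K] [Algebra k K]
    [Algebra (MvPolynomial (Fin 2) k) K] [IsFractionRing (MvPolynomial (Fin 2) k) K]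
    [IsScalarTower k (MvPolynomial (Fin 2) k) K] {s t d : ℕ} (hst : s ≤ t) (htd : t ≤ d)
    {α : ℕ → k} (hαs : α s ≠ 0) (hαt : α t ≠ 0) {h₁ h₂ : Polynomial k}
    (hA : Polynomial.aeval (homogSum s t d α) h₁ ≠ 0)
    (hB : Polynomial.aeval (homogSum s t d α) h₂ ≠ 0)
    (hcop : s < t → IsCoprime h₁ h₂) :
    Module.finrank (IntermediateField.adjoin k
      ({algebraMap _ _ (X 0 * Polynomial.aeval (homogSum s t d α) h₁),
        algebraMap _ _ (X 1 * Polynomial.aeval (homogSum s t d α) h₂)} : Set K)) K =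
      t * h₁.natDegree + (d - s) * h₂.natDegree + 1 := by
  set u := homogSum s t d α with hu
  set f₁ := X 0 * Polynomial.aeval u h₁ with hf₁
  set f₂ := X 1 * Polynomial.aeval u h₂ with hf₂
  have hh₁ : h₁ ≠ 0 := by rintro rfl; simp at hA
  have hh₂ : h₂ ≠ 0 := by rintro rfl; simp at hB
  have hset : ({algebraMap _ _ f₁, algebraMap _ _ f₂} : Set K) =
      Set.range ((algebraMap _ K) ∘ ![f₁, f₂]) := by
    rw [Set.range_comp]
    simp [Matrix.range_cons, Set.image_insert_eq, Set.pair_comm]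
  rw [hset]
  set F := IntermediateField.adjoin k (Set.range ((algebraMap _ K) ∘ ![f₁, f₂])) with hF
  have hm (i : Fin 2) : algebraMap _ K (![f₁, f₂] i) ∈ F :=
    IntermediateField.subset_adjoin _ _ ⟨i, rfl⟩
  let y₁ : F := ⟨algebraMap _ K f₁, hm 0⟩
  let y₂ : F := ⟨algebraMap _ K f₂, hm 1⟩
  let x : K := algebraMap _ K u
  let M : Polynomial F := relPoly s t d α h₁ h₂ y₁ y₂
  have hMdeg : M.natDegree = _ := natDegree_relPoly htd α hh₁ hh₂ y₁ y₂
  have hM0 : M ≠ 0 := by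
    rintro h
    rw [h] at hMdeg
    simp at hMdeg
  have hMx : Polynomial.aeval x M = 0 := by
    have h := aeval_relPoly_eq_zero (S := K) (s := s) htd α h₁ h₂
      (algebraMap (MvPolynomial (Fin 2) k) K (X 0))
      (algebraMap (MvPolynomial (Fin 2) k) K (X 1)) x (by
        simp only [x, hu, homogSum, map_sum, map_mul, map_pow, ← algebraMap_eq,
          ← IsScalarTower.algebraMap_apply])
    rw [Polynomial.aeval_algebraMap_apply, Polynomial.aeval_algebraMap_apply, ← map_mul,
      ← map_mul] at h
    rw [← h, ← Polynomial.eval_map_algebraMap, map_relPoly]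
    rfl
  have hint : IsIntegral F x := isAlgebraic_iff_isIntegral.mp ⟨M, hM0, hMx⟩
  have hfin : Module.finrank F K = (minpoly F x).natDegree := by
    rw [← IntermediateField.adjoin.finrank hint, ← IntermediateField.finrank_top',
      adjoin_adjoin_eq_top u hA hB F (hm 0) (hm 1)]
  rw [hfin]
  refine le_antisymm ?_ ?_
  · rw [← hMdeg]
    exact Polynomial.natDegree_le_natDegree (minpoly.degree_le_of_ne_zero F x hM0 hMx)
  · rcases Nat.eq_zero_or_pos d with rfl | hd
    · have : t = 0 := by omega
      simpa [this] using Nat.one_le_iff_ne_zero.mpr (minpoly.natDegree_pos hint).ne'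
    obtain ⟨Q, hQ0, hQdeg, hQ⟩ := exists_polynomial_of_aeval_adjoin _ _ (minpoly.ne_zero hint)
      (minpoly.aeval F x)
    refine le_trans ?_ hQdeg
    rw [← natDegree_relPoly htd α hh₁ hh₂ (X 0 : MvPolynomial (Fin 2) k) (X 1)]
    refine Polynomial.natDegree_le_of_dvd
      (relPoly_dvd hd hst htd hαs hαt hh₁ hh₂ hcop Q ?_) hQ0
    apply IsFractionRing.injective (MvPolynomial (Fin 2) k) K
    rw [Polynomial.hom_eval₂, map_zero, ← hQ]
    congr 1
    refine MvPolynomial.ringHom_ext (fun a => ?_) fun i => ?_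
    · simp [IsScalarTower.algebraMap_apply k (MvPolynomial (Fin 2) k) K, algebraMap_eq]
    · simp [hf₁, hf₂, hu]

theorem stmt_16 {k : Type*} [Field k] (p : ℕ) (hp : 0 < p) [CharP k p]
    (s t d : ℕ) (hst : s ≤ t) (htd : t ≤ d)
    (α : ℕ → k) (hαs : α s ≠ 0) (hαt : α t ≠ 0)
    (h₁ h₂ : Polynomial k) :
    let u : MvPolynomial (Fin 2) k :=
      ∑ j ∈ Finset.Icc s t, C (α j) * X 0 ^ j * X 1 ^ (d - j)
    let f₁ : MvPolynomial (Fin 2) k := X 0 * Polynomial.aeval u h₁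
    let f₂ : MvPolynomial (Fin 2) k := X 1 * Polynomial.aeval u h₂
    let K := FractionRing (MvPolynomial (Fin 2) k)
    let ι : MvPolynomial (Fin 2) k →+* K := algebraMap _ _
    (∃ c : k, c ≠ 0 ∧
        pderiv 0 f₁ * pderiv 1 f₂ - pderiv 1 f₁ * pderiv 0 f₂ = C c) →
      Module.finrank (IntermediateField.adjoin k {ι f₁, ι f₂}) K =
        t * h₁.natDegree + (d - s) * h₂.natDegree + 1 := by
  intro u f₁ f₂ K ι ⟨c, hc, hJ⟩
  have hcC : (C c : MvPolynomial (Fin 2) k) ≠ 0 := by simpa using hc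
  refine finrank_adjoin hst htd hαs hαt (fun h => hcC ?_) (fun h => hcC ?_)
    fun hlt => isCoprime_of_jacobian hlt hαt hc hJ
  · have : f₁ = 0 := mul_eq_zero_of_right _ h
    simp [← hJ, this]
  · have : f₂ = 0 := mul_eq_zero_of_right _ h
    simp [← hJ, this]
end
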